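/- arXiv:1903.05494 — 2 statements merged into one kernel-verified Lean document; each statement's English description precedes it below -/
import Mathlib

section
/- Let C_0, C_1, ..., C_{s−1} ⊆ F_q^n be linear codes, 1 ≤ s ≤ q−1, and let C = [C_0, ..., C_{s−1}]V_q(s) with V_q(s) the s×(q−1) Vandermonde matrix built from the distinct nonzero elements of F_q. Set s̃ = min{2s−1, q−1}. Then d(C^{*2}) ≥ min over l ∈ {0, 1, ..., s̃−1} of (q − l − 1)·d(Σ_{i+j ≡ l (mod q−1), 0 ≤ i,j ≤ s−1} C_i * C_j). -/
open scoped Pointwise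

/-- Hamming weight of a vector. -/
noncomputable def wt {ι F : Type*} [Fintype ι] [Zero F] (x : ι → F) : ℕ :=
  letI := Classical.decEq F
  (Finset.univ.filter fun i => x i ≠ 0).card

/-- Minimum distance (= minimum weight) of a code given as a set. -/
noncomputable def minDist {ι F : Type*} [Fintype ι] [Zero F] (C : Set (ι → F)) : ℕ :=
  sInf (wt '' {x ∈ C | x ≠ 0})

/-- The matrix-product code `[C_1, …, C_s]A`, a subspace of `F^{l·n}`: the codeword
corresponding to `(c_1,…,c_s)` has `(j,k)` entry `∑ i, A i j * (c i) k`. -/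
noncomputable def matrixProdCode {F : Type*} [Field F] {n s l : ℕ}
    (C : Fin s → Submodule F (Fin n → F)) (A : Matrix (Fin s) (Fin l) F) :
    Submodule F (Fin l × Fin n → F) :=
  Submodule.map
    (show (Fin s → Fin n → F) →ₗ[F] (Fin l × Fin n → F) from
      { toFun := fun c (jk : Fin l × Fin n) => ∑ i, A i jk.1 * c i jk.2
        map_add' := by
          intro a b; funext jk
          simp [mul_add, Finset.sum_add_distrib]
        map_smul' := by
          intro r a; funext jk
          simp [Finset.mul_sum, mul_left_comm] })
    (Submodule.pi Set.univ C)

/-- Componentwise (Schur) product of two codes. -/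
def schurProd {F : Type*} [Field F] {ι : Type*} (C C' : Submodule F (ι → F)) :
    Submodule F (ι → F) :=
  Submodule.span F {x | ∃ c ∈ C, ∃ c' ∈ C', x = c * c'}

theorem wt_eq_card_filter {ι F : Type*} [Fintype ι] [Zero F] [DecidableEq F] (x : ι → F) :
    wt x = (Finset.univ.filter fun i => x i ≠ 0).card := by
  unfold wt
  congr!

theorem minDist_le_wt {ι F : Type*} [Fintype ι] [Zero F] {C : Set (ι → F)} {x : ι → F}
    (hx : x ∈ C) (hx0 : x ≠ 0) : minDist C ≤ wt x :=
  Nat.sInf_le ⟨x, ⟨hx, hx0⟩, rfl⟩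

/-- A nonzero polynomial of degree at most `l` is nonzero at all but `l` of `m` distinct points. -/
theorem sub_le_card_filter_eval_ne_zero {F : Type*} [Field F] [DecidableEq F] {m l : ℕ}
    {α : Fin m → F} (hα : Function.Injective α) {p : Polynomial F} (hp : p ≠ 0)
    (hl : p.natDegree ≤ l) :
    m - l ≤ (Finset.univ.filter fun j => p.eval (α j) ≠ 0).card := by
  have hroots : (Finset.univ.filter fun j => p.eval (α j) = 0).card ≤ l := by
    calc _ ≤ p.roots.toFinset.card :=
          Finset.card_le_card_of_injOn α (fun j hj => by simpa [hp] using hj) hα.injOn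
      _ ≤ p.roots.card := p.roots.toFinset_card_le
      _ ≤ l := p.card_roots'.trans hl
  have hsplit := Finset.card_filter_add_card_filter_not (s := (Finset.univ : Finset (Fin m)))
    (fun j => p.eval (α j) = 0)
  simp only [Finset.card_univ, Fintype.card_fin] at hsplit
  simp only [ne_eq]
  omega

/-- A nonzero word whose blocks are the values at distinct points of a polynomial with vector
coefficients has weight at least `m - l` times the weight of its leading coefficient. -/
theorem exists_mul_wt_le_wt_eval {F : Type*} [Field F] {m n N : ℕ}
    {α : Fin m → F} (hα : Function.Injective α) (d : ℕ → Fin n → F)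
    {x : Fin m × Fin n → F} (hx0 : x ≠ 0)
    (hx : ∀ j k, x (j, k) = ∑ l ∈ Finset.range N, α j ^ l * d l k) :
    ∃ l < N, d l ≠ 0 ∧ (m - l) * wt (d l) ≤ wt x := by
  classical
  have hS : ((Finset.range N).filter fun l => d l ≠ 0).Nonempty := by
    by_contra hS
    rw [Finset.not_nonempty_iff_eq_empty, Finset.filter_eq_empty_iff] at hS
    refine hx0 (funext fun ⟨j, k⟩ => ?_)
    rw [hx]
    exact Finset.sum_eq_zero fun l hl => by simp [not_not.mp (hS hl)]
  obtain ⟨l, hl, hmax⟩ := Finset.exists_max_image _ id hS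
  simp only [Finset.mem_filter, Finset.mem_range, id, and_imp] at hl hmax
  refine ⟨l, hl.1, hl.2, ?_⟩
  let p : Fin n → Polynomial F := fun k =>
    ∑ i ∈ Finset.range N, Polynomial.monomial i (d i k)
  have hdeg (k) : (p k).natDegree ≤ l := by
    refine Polynomial.natDegree_sum_le_of_forall_le _ _ fun i hi => ?_
    by_cases hi0 : d i = 0
    · simp [hi0]
    · exact (Polynomial.natDegree_monomial_le _).trans (hmax i (Finset.mem_range.mp hi) hi0)
  have hcoeff (k) : (p k).coeff l = d l k := by
    simp [p, Polynomial.coeff_monomial, hl.1]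
  have heval (j k) : (p k).eval (α j) = x (j, k) := by
    simp [p, hx, Polynomial.eval_finsetSum, mul_comm]
  have hwt : wt x = ∑ k, (Finset.univ.filter fun j => x (j, k) ≠ 0).card := by
    simp only [wt_eq_card_filter, Finset.card_filter, Fintype.sum_prod_type_right]
  rw [hwt, wt_eq_card_filter, mul_comm, ← smul_eq_mul, ← Finset.sum_const]
  refine (Finset.sum_le_sum fun k hk => ?_).trans
    (Finset.sum_le_sum_of_subset (Finset.filter_subset _ _))
  have hpk : p k ≠ 0 := fun h => (Finset.mem_filter.mp hk).2 (by simp [← hcoeff, h])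
  simpa only [heval] using sub_le_card_filter_eval_ne_zero hα hpk (hdeg k)

/-- The code `∑_{i+j ≡ l (mod m)} C_i * C_j`. -/
abbrev residueSchurSum {F : Type*} [Field F] {n s : ℕ} (m : ℕ)
    (C : Fin s → Submodule F (Fin n → F)) (l : ℕ) : Submodule F (Fin n → F) :=
  ⨆ (p : Fin s × Fin s) (_ : ((p.1 : ℕ) + (p.2 : ℕ)) % m = l), schurProd (C p.1) (C p.2)

/-- Words of the square of a Vandermonde matrix-product code at `m`-th roots of unity are values
of polynomials whose `l`-th coefficient lies in `∑_{i+j ≡ l (mod m)} C_i * C_j`. -/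
theorem exists_coeff_of_mem_schurProd_vandermonde {F : Type*} [Field F] {n s m : ℕ}
    (hs : 0 < s) (hm : 0 < m) {α : Fin m → F} (hα : ∀ j, α j ^ m = 1)
    (C : Fin s → Submodule F (Fin n → F)) {x : Fin m × Fin n → F}
    (hx : x ∈ schurProd
      (matrixProdCode C (Matrix.of fun (i : Fin s) (j : Fin m) => α j ^ (i : ℕ)))
      (matrixProdCode C (Matrix.of fun (i : Fin s) (j : Fin m) => α j ^ (i : ℕ)))) :
    ∃ d : ℕ → Fin n → F, (∀ l, d l ∈ residueSchurSum m C l) ∧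
      ∀ j k, x (j, k) = ∑ l ∈ Finset.range (min (2 * s - 1) m), α j ^ l * d l k := by
  induction hx using Submodule.span_induction with
  | mem x hx =>
    obtain ⟨_, ⟨a, ha, rfl⟩, _, ⟨b, hb, rfl⟩, rfl⟩ := hx
    have ha' (i) : a i ∈ C i := ha i (Set.mem_univ i)
    have hb' (i) : b i ∈ C i := hb i (Set.mem_univ i)
    refine ⟨fun l => ∑ p : Fin s × Fin s with ((p.1 : ℕ) + (p.2 : ℕ)) % m = l, a p.1 * b p.2,
      fun l => Submodule.sum_mem _ fun p hp => ?_, fun j k => ?_⟩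
    · exact Submodule.mem_iSup_of_mem p (Submodule.mem_iSup_of_mem (Finset.mem_filter.mp hp).2
        (Submodule.subset_span ⟨_, ha' _, _, hb' _, rfl⟩))
    · have hmaps : ∀ p ∈ (Finset.univ : Finset (Fin s × Fin s)),
          ((p.1 : ℕ) + (p.2 : ℕ)) % m ∈ Finset.range (min (2 * s - 1) m) := by
        intro p _
        have h1 := Nat.mod_le ((p.1 : ℕ) + (p.2 : ℕ)) m
        have h2 := Nat.mod_lt ((p.1 : ℕ) + (p.2 : ℕ)) hm
        rw [Finset.mem_range]
        omega
      change (∑ i : Fin s, α j ^ (i : ℕ) * a i k) * (∑ i : Fin s, α j ^ (i : ℕ) * b i k) = _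
      rw [Fintype.sum_mul_sum, ← Fintype.sum_prod_type', ← Finset.sum_fiberwise_of_maps_to hmaps]
      refine Finset.sum_congr rfl fun l _ => ?_
      beta_reduce
      rw [Finset.sum_apply, Finset.mul_sum]
      refine Finset.sum_congr rfl fun p hp => ?_
      rw [← (Finset.mem_filter.mp hp).2, ← pow_eq_pow_mod _ (hα j), Pi.mul_apply]
      ring
  | zero => exact ⟨0, fun l => Submodule.zero_mem _, by simp⟩
  | add x y _ _ hx hy =>
    obtain ⟨d, hd, hxd⟩ := hx
    obtain ⟨e, he, hye⟩ := hy
    exact ⟨d + e, fun l => Submodule.add_mem _ (hd l) (he l), fun j k => by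
      simp [hxd, hye, mul_add, Finset.sum_add_distrib]⟩
  | smul r x _ hx =>
    obtain ⟨d, hd, hxd⟩ := hx
    exact ⟨r • d, fun l => Submodule.smul_mem _ r (hd l), fun j k => by
      simp [hxd, Finset.mul_sum, mul_left_comm]⟩

theorem residueSchurSum_eq_bot {F : Type*} [Field F] {n s : ℕ} (m : ℕ)
    {C : Fin s → Submodule F (Fin n → F)} (hC : ∀ i, C i = ⊥) (l : ℕ) :
    residueSchurSum m C l = ⊥ := by
  simp only [residueSchurSum, iSup_eq_bot]
  intro p _
  refine Submodule.span_eq_bot.mpr ?_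
  rintro _ ⟨c, hc, c', -, rfl⟩
  simp [(Submodule.eq_bot_iff _).mp (hC p.1) c hc]

theorem minDist_bot {ι F : Type*} [Fintype ι] [Field F] :
    minDist ((⊥ : Submodule F (ι → F)) : Set (ι → F)) = 0 := by
  have : {x ∈ ((⊥ : Submodule F (ι → F)) : Set (ι → F)) | x ≠ 0} = ∅ := by
    ext x; simp
  rw [minDist, this, Set.image_empty, Nat.sInf_empty]

theorem eq_bot_of_schurProd_self_eq_bot {F : Type*} [Field F] {ι : Type*}
    {C : Submodule F (ι → F)} (h : schurProd C C = ⊥) : C = ⊥ := by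
  refine (Submodule.eq_bot_iff _).mpr fun c hc => funext fun i => ?_
  have hcc : c * c = 0 :=
    (Submodule.eq_bot_iff _).mp h _ (Submodule.subset_span ⟨c, hc, c, hc, rfl⟩)
  exact mul_self_eq_zero.mp (congrFun hcc i)

/-- If some column of `A` has no zero entry, a zero matrix-product code has zero constituents. -/
theorem eq_bot_of_matrixProdCode_eq_bot {F : Type*} [Field F] {n s l : ℕ}
    {C : Fin s → Submodule F (Fin n → F)} {A : Matrix (Fin s) (Fin l) F}
    (h : matrixProdCode C A = ⊥) (j : Fin l) (hA : ∀ i, A i j ≠ 0) (i : Fin s) :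
    C i = ⊥ := by
  refine (Submodule.eq_bot_iff _).mpr fun c hc => funext fun k => ?_
  have hmem : Pi.single i c ∈ Submodule.pi Set.univ C := by
    intro i' _
    by_cases hi : i' = i
    · subst hi; simpa using hc
    · simp [hi]
  have h0 := (Submodule.eq_bot_iff _).mp h _ (Submodule.mem_map_of_mem hmem)
  have hjk : ∑ i', A i' j * (Pi.single i c : Fin s → Fin n → F) i' k = 0 := congrFun h0 (j, k)
  rw [Finset.sum_eq_single i (fun i' _ hi => by simp [hi]) (by simp), Pi.single_eq_same] at hjk
  exact (mul_eq_zero.mp hjk).resolve_left (hA i)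

/-- For `C = [C_0,…,C_{s-1}]V_q(s)` with `V_q(s)` the Vandermonde
matrix built from the distinct nonzero elements of `F_q` and `s̃ = min{2s-1, q-1}`,
`d(C^{*2}) ≥ min_{l < s̃} (q - l - 1) · d(∑_{i+j ≡ l (mod q-1)} C_i * C_j)`. -/
theorem vandermonde_square_minDist
    {F : Type*} [Field F] [Fintype F] {n s : ℕ}
    (hs : 0 < s) (hsq : s ≤ Fintype.card F - 1)
    (α : Fin (Fintype.card F - 1) → F)
    (hαinj : Function.Injective α) (hα0 : ∀ j, α j ≠ 0)
    (C : Fin s → Submodule F (Fin n → F)) :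
    ⨅ l : Fin (min (2 * s - 1) (Fintype.card F - 1)),
        (Fintype.card F - (l : ℕ) - 1) *
          minDist ((⨆ (p : Fin s × Fin s)
              (_ : ((p.1 : ℕ) + (p.2 : ℕ)) % (Fintype.card F - 1) = (l : ℕ)),
              schurProd (C p.1) (C p.2) : Submodule F (Fin n → F)) : Set (Fin n → F))
      ≤ minDist (schurProd
          (matrixProdCode C
            (Matrix.of fun (i : Fin s) (j : Fin (Fintype.card F - 1)) => α j ^ (i : ℕ)))
          (matrixProdCode C
            (Matrix.of fun (i : Fin s) (j : Fin (Fintype.card F - 1)) => α j ^ (i : ℕ))) :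
        Set (Fin (Fintype.card F - 1) × Fin n → F)) := by
  have hm : 0 < Fintype.card F - 1 := hs.trans_le hsq
  rcases Set.eq_empty_or_nonempty {x ∈ (schurProd
      (matrixProdCode C (Matrix.of fun (i : Fin s) j => α j ^ (i : ℕ)))
      (matrixProdCode C (Matrix.of fun (i : Fin s) j => α j ^ (i : ℕ))) :
        Set (Fin (Fintype.card F - 1) × Fin n → F)) | x ≠ 0} with hempty | hne
  · have hsq0 := (Submodule.eq_bot_iff _).mpr fun x hx =>
      not_not.mp fun hx0 => (Set.eq_empty_iff_forall_notMem.mp hempty) x ⟨hx, hx0⟩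
    have hC := eq_bot_of_matrixProdCode_eq_bot (eq_bot_of_schurProd_self_eq_bot hsq0) ⟨0, hm⟩
      fun i => pow_ne_zero _ (hα0 _)
    refine (ciInf_le (OrderBot.bddBelow _) ⟨0, by omega⟩).trans ?_
    simp only [residueSchurSum_eq_bot _ hC, minDist_bot, mul_zero, Nat.zero_le]
  · obtain ⟨x, ⟨hx, hx0⟩, hxmin⟩ := Nat.sInf_mem (hne.image wt)
    obtain ⟨d, hd, hxd⟩ := exists_coeff_of_mem_schurProd_vandermonde hs hm
      (fun j => FiniteField.pow_card_sub_one_eq_one _ (hα0 j)) C hx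
    obtain ⟨l, hl, hl0, hle⟩ := exists_mul_wt_le_wt_eval hαinj d hx0 hxd
    rw [minDist, ← hxmin]
    refine (ciInf_le (OrderBot.bddBelow _) ⟨l, hl⟩).trans (le_trans ?_ hle)
    rw [Nat.sub_right_comm]
    exact Nat.mul_le_mul_left _ (minDist_le_wt (hd l) hl0)
end

section
/- Let p be a prime, let F_q have characteristic p, and let C_1 ⊇ C_2 ⊇ ... ⊇ C_p be nested linear codes in F_q^n. Let MS_p be the p×p matrix over F_q whose (i,j) entry is the binomial coefficient C(p−i, j−1) reduced mod p, and let MS_p^* be the p×p matrix whose (i,j) entry is C(p−i, j−1)·C(p−1, j−1) reduced mod p. Set C = [C_1, C_2, ..., C_p]MS_p. Then C^{*2} = [D_2, D_3, ..., D_{p+1}]MS_p^*, where for each l with 2 ≤ l ≤ p+1, D_l = Σ_{i+j = l, 1 ≤ i,j ≤ p} C_i * C_j. -/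
open scoped Pointwise

/-- The sequence `j ↦ binom(m + j, j)` in `F`, a polynomial function of degree `m` in `j`. -/
def chooseSeq (F : Type*) [Field F] (m : ℕ) : ℕ → F := fun j => ((m + j).choose j : F)

theorem succ_mul_chooseSeq_succ {F : Type*} [Field F] (m j : ℕ) :
    ((m : F) + 1) * chooseSeq F (m + 1) j = ((j : F) + m + 1) * chooseSeq F m j := by
  have h := Nat.choose_mul_succ_eq (m + j) j
  have e : m + j + 1 - j = m + 1 := by omega
  rw [e] at h
  have h' := congrArg (Nat.cast : ℕ → F) h
  push_cast at h'
  unfold chooseSeq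
  rw [show m + 1 + j = m + j + 1 by ring]
  linear_combination -h'

theorem cast_ne_zero_of_pos_of_lt {F : Type*} [Field F] {p : ℕ} [CharP F p] {a : ℕ}
    (h0 : 0 < a) (h : a < p) : (a : F) ≠ 0 := by
  rw [Ne, CharP.cast_eq_zero_iff F p]
  exact fun hd => absurd (Nat.le_of_dvd h0 hd) (by omega)

theorem cast_choose_sub_one_sub {F : Type*} [Field F] {p : ℕ} [CharP F p] {i : ℕ} (hi : i < p) :
    ∀ {j : ℕ}, j < p → ((p - 1 - i).choose j : F) = (-1) ^ j * chooseSeq F i j := by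
  intro j
  induction j with
  | zero => simp [chooseSeq]
  | succ j ih =>
    intro hj
    have hne : ((j : F) + 1) ≠ 0 := by
      exact_mod_cast cast_ne_zero_of_pos_of_lt (F := F) (p := p) (Nat.succ_pos j) hj
    have h1 : ((p - 1 - i).choose (j + 1) : F) * (j + 1)
        = (p - 1 - i).choose j * (-(i + j + 1)) := by
      have h := congrArg (Nat.cast : ℕ → F) (Nat.choose_succ_right_eq (p - 1 - i) j)
      push_cast at h
      rw [h]
      rcases le_or_gt j (p - 1 - i) with hle | hgt
      · congr 1
        have h2 : (p - 1 - i - j) + (i + j + 1) = p := by omega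
        have h3 := congrArg (Nat.cast : ℕ → F) h2
        push_cast at h3
        rw [CharP.cast_eq_zero F p] at h3
        linear_combination h3
      · simp [Nat.choose_eq_zero_of_lt hgt]
    have h2 : chooseSeq F i (j + 1) * (j + 1) = chooseSeq F i j * (i + j + 1) := by
      have h := congrArg (Nat.cast : ℕ → F) (Nat.add_one_mul_choose_eq (i + j) j)
      push_cast at h
      unfold chooseSeq
      rw [← add_assoc]
      linear_combination -h
    apply mul_right_cancel₀ hne
    rw [h1, ih (by omega)]
    linear_combination -(-1 : F) ^ (j + 1) * h2

/-- The span of the sequences `chooseSeq F m` with `m < p` and `m < k`. -/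
def chooseSpan (F : Type*) [Field F] (p k : ℕ) : Submodule F (ℕ → F) :=
  Submodule.span F (chooseSeq F '' {m | m < p ∧ m < k})

theorem chooseSeq_mem_chooseSpan {F : Type*} [Field F] {p k m : ℕ} (hp : m < p) (hk : m < k) :
    chooseSeq F m ∈ chooseSpan F p k :=
  Submodule.subset_span ⟨m, ⟨hp, hk⟩, rfl⟩

theorem chooseSpan_mono {F : Type*} [Field F] {p k l : ℕ} (h : k ≤ l) :
    chooseSpan F p k ≤ chooseSpan F p l :=
  Submodule.span_mono (Set.image_mono fun _ hm => ⟨hm.1, hm.2.trans_le h⟩)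

theorem cast_add_mul_mem_chooseSpan {F : Type*} [Field F] {p : ℕ} [CharP F p] {k : ℕ} (c : F)
    {g : ℕ → F} (hg : g ∈ chooseSpan F p k) :
    (fun j : ℕ => (j : F) + c) * g ∈ chooseSpan F p (k + 1) := by
  induction hg using Submodule.span_induction with
  | mem x hx =>
    obtain ⟨m, ⟨hmp, hmk⟩, rfl⟩ := hx
    have e : (fun j : ℕ => (j : F) + c) * chooseSeq F m
        = ((m : F) + 1) • chooseSeq F (m + 1) + (c - m - 1) • chooseSeq F m := by
      funext j
      simp only [Pi.mul_apply, Pi.add_apply, Pi.smul_apply, smul_eq_mul]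
      linear_combination -(succ_mul_chooseSeq_succ (F := F) m j)
    rw [e]
    refine add_mem ?_ (Submodule.smul_mem _ _ (chooseSeq_mem_chooseSpan hmp (by omega)))
    rcases Nat.lt_or_ge (m + 1) p with h | h
    · exact Submodule.smul_mem _ _ (chooseSeq_mem_chooseSpan h (by omega))
    · have h0 : ((m : F) + 1) = 0 := by
        have h1 : m + 1 = p := by omega
        have h2 := CharP.cast_eq_zero F p
        rw [← h1] at h2
        exact_mod_cast h2
      rw [h0, zero_smul]
      exact zero_mem _
  | zero => rw [mul_zero]; exact zero_mem _
  | add x y _ _ hx hy => rw [mul_add]; exact add_mem hx hy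
  | smul r x _ hx => rw [mul_smul_comm]; exact Submodule.smul_mem _ _ hx

theorem succ_smul_chooseSeq_succ_mul {F : Type*} [Field F] (a : ℕ) (g : ℕ → F) :
    ((a : F) + 1) • (chooseSeq F (a + 1) * g)
      = (fun j : ℕ => (j : F) + (a + 1)) * (chooseSeq F a * g) := by
  funext j
  simp only [Pi.mul_apply, Pi.smul_apply, smul_eq_mul]
  linear_combination g j * succ_mul_chooseSeq_succ (F := F) a j

theorem chooseSeq_zero_mul {F : Type*} [Field F] (g : ℕ → F) : chooseSeq F 0 * g = g := by
  funext j
  simp [chooseSeq]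

theorem chooseSeq_mul_mem_chooseSpan {F : Type*} [Field F] {p : ℕ} [CharP F p] {b : ℕ}
    (hb : b < p) : ∀ {a : ℕ}, a < p → chooseSeq F a * chooseSeq F b ∈ chooseSpan F p (a + b + 1) := by
  intro a
  induction a with
  | zero =>
    intro _
    rw [chooseSeq_zero_mul]
    exact chooseSeq_mem_chooseSpan hb (by omega)
  | succ a ih =>
    intro ha
    have hne : ((a : F) + 1) ≠ 0 := by
      exact_mod_cast cast_ne_zero_of_pos_of_lt (F := F) (p := p) (Nat.succ_pos a) ha
    rw [← Submodule.smul_mem_iff _ hne, succ_smul_chooseSeq_succ_mul,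
      show a + 1 + b + 1 = a + b + 1 + 1 by ring]
    exact cast_add_mul_mem_chooseSpan _ (ih (by omega))

theorem exists_chooseSeq_mul_sub_mem {F : Type*} [Field F] {p : ℕ} [CharP F p] {b : ℕ} :
    ∀ {a : ℕ}, a + b < p → ∃ t : F, t ≠ 0 ∧
      chooseSeq F a * chooseSeq F b - t • chooseSeq F (a + b) ∈ chooseSpan F p (a + b) := by
  intro a
  induction a with
  | zero =>
    intro _
    refine ⟨1, one_ne_zero, ?_⟩
    rw [chooseSeq_zero_mul, one_smul, zero_add, sub_self]
    exact zero_mem _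
  | succ a ih =>
    intro hab
    obtain ⟨t, ht, hmem⟩ := ih (by omega)
    have hne : ((a : F) + 1) ≠ 0 := by
      exact_mod_cast cast_ne_zero_of_pos_of_lt (F := F) (p := p) (Nat.succ_pos a) (by omega)
    have hne' : ((a + b : ℕ) : F) + 1 ≠ 0 := by
      exact_mod_cast cast_ne_zero_of_pos_of_lt (F := F) (p := p) (Nat.succ_pos (a + b)) (by omega)
    refine ⟨t * (((a + b : ℕ) : F) + 1) / (a + 1), div_ne_zero (mul_ne_zero ht hne') hne, ?_⟩
    rw [← Submodule.smul_mem_iff _ hne, smul_sub, succ_smul_chooseSeq_succ_mul, smul_smul,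
      mul_div_cancel₀ _ hne, show a + 1 + b = a + b + 1 by ring]
    have e : (fun j : ℕ => (j : F) + (a + 1)) * (chooseSeq F a * chooseSeq F b)
          - (t * (((a + b : ℕ) : F) + 1)) • chooseSeq F (a + b + 1)
        = (fun j : ℕ => (j : F) + (a + 1)) *
            (chooseSeq F a * chooseSeq F b - t • chooseSeq F (a + b))
          + (-(t * b)) • chooseSeq F (a + b) := by
      funext j
      have h := succ_mul_chooseSeq_succ (F := F) (a + b) j
      simp only [Pi.mul_apply, Pi.add_apply, Pi.sub_apply, Pi.smul_apply, smul_eq_mul]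
      push_cast at h ⊢
      linear_combination -t * h
    rw [e]
    exact add_mem (cast_add_mul_mem_chooseSpan _ hmem)
      (Submodule.smul_mem _ _ (chooseSeq_mem_chooseSpan (by omega) (by omega)))

theorem mul_mem_matrixProdCode {F : Type*} [Field F] {n s l : ℕ}
    {C : Fin s → Submodule F (Fin n → F)} (A : Matrix (Fin s) (Fin l) F) {i : Fin s}
    {c : Fin n → F} (hc : c ∈ C i) :
    (fun jk : Fin l × Fin n => A i jk.1 * c jk.2) ∈ matrixProdCode C A := by
  refine ⟨Pi.single i c, ?_, ?_⟩
  · intro i' _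
    rcases eq_or_ne i' i with rfl | h
    · simpa using hc
    · simp [h]
  · funext jk
    change ∑ i', A i' jk.1 * (Pi.single i c : Fin s → Fin n → F) i' jk.2 = _
    rw [Finset.sum_eq_single i]
    · simp
    · intro i' _ h
      simp [h]
    · simp

theorem exists_of_mem_matrixProdCode {F : Type*} [Field F] {n s l : ℕ}
    {C : Fin s → Submodule F (Fin n → F)} {A : Matrix (Fin s) (Fin l) F}
    {x : Fin l × Fin n → F} (hx : x ∈ matrixProdCode C A) :
    ∃ c : Fin s → Fin n → F, (∀ i, c i ∈ C i) ∧
      x = fun jk => ∑ i, A i jk.1 * c i jk.2 := by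
  obtain ⟨c, hc, rfl⟩ := hx
  exact ⟨c, fun i => hc i trivial, rfl⟩

theorem matrixProdCode_le {F : Type*} [Field F] {n s l : ℕ}
    {C : Fin s → Submodule F (Fin n → F)} {A : Matrix (Fin s) (Fin l) F}
    {S : Submodule F (Fin l × Fin n → F)}
    (h : ∀ i, ∀ c ∈ C i, (fun jk : Fin l × Fin n => A i jk.1 * c jk.2) ∈ S) :
    matrixProdCode C A ≤ S := by
  intro x hx
  obtain ⟨c, hc, rfl⟩ := exists_of_mem_matrixProdCode hx
  have e : (fun jk : Fin l × Fin n => ∑ i, A i jk.1 * c i jk.2)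
      = ∑ i, fun jk : Fin l × Fin n => A i jk.1 * c i jk.2 := by
    funext jk
    simp
  rw [e]
  exact sum_mem fun i _ => h i _ (hc i)

theorem schurProd_matrixProdCode_le {F : Type*} [Field F] {n s l : ℕ}
    {C : Fin s → Submodule F (Fin n → F)} {A : Matrix (Fin s) (Fin l) F}
    {S : Submodule F (Fin l × Fin n → F)}
    (h : ∀ a b, ∀ c ∈ C a, ∀ c' ∈ C b,
      (fun jk : Fin l × Fin n => A a jk.1 * A b jk.1 * (c * c') jk.2) ∈ S) :
    schurProd (matrixProdCode C A) (matrixProdCode C A) ≤ S := by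
  refine Submodule.span_le.2 ?_
  rintro _ ⟨u, hu, v, hv, rfl⟩
  obtain ⟨c, hc, rfl⟩ := exists_of_mem_matrixProdCode hu
  obtain ⟨c', hc', rfl⟩ := exists_of_mem_matrixProdCode hv
  have e : (fun jk : Fin l × Fin n => ∑ i, A i jk.1 * c i jk.2)
        * (fun jk : Fin l × Fin n => ∑ i, A i jk.1 * c' i jk.2)
      = ∑ a, ∑ b, fun jk : Fin l × Fin n => A a jk.1 * A b jk.1 * (c a * c' b) jk.2 := by
    funext jk
    simp only [Pi.mul_apply, Finset.sum_apply, Finset.sum_mul_sum]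
    exact Finset.sum_congr rfl fun a _ => Finset.sum_congr rfl fun b _ => by ring
  rw [SetLike.mem_coe, e]
  exact sum_mem fun a _ => sum_mem fun b _ => h a b _ (hc a) _ (hc' b)

/-- The linear map `(g, x) ↦ g ⊗ x`, restricting the sequence `g` to its first `p` terms. -/
def seqTensor (F : Type*) [Field F] (p n : ℕ) :
    (ℕ → F) →ₗ[F] (Fin n → F) →ₗ[F] (Fin p × Fin n → F) :=
  LinearMap.mk₂ F (fun g x jk => g jk.1 * x jk.2)
    (fun _ _ _ => funext fun _ => add_mul _ _ _)
    (fun _ _ _ => funext fun _ => mul_assoc _ _ _)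
    (fun _ _ _ => funext fun _ => mul_add _ _ _)
    (fun _ _ _ => funext fun _ => mul_left_comm _ _ _)

theorem seqTensor_mem_of_mem_chooseSpan {F : Type*} [Field F] {p n k : ℕ} {x : Fin n → F}
    {S : Submodule F (Fin p × Fin n → F)} {g : ℕ → F} (hg : g ∈ chooseSpan F p k)
    (h : ∀ m < p, m < k → seqTensor F p n (chooseSeq F m) x ∈ S) :
    seqTensor F p n g x ∈ S := by
  have hle : chooseSpan F p k ≤ S.comap ((seqTensor F p n).flip x) := by
    refine Submodule.span_le.2 ?_
    rintro _ ⟨m, ⟨hmp, hmk⟩, rfl⟩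
    exact h m hmp hmk
  exact hle hg

theorem exists_fin_add_eq {p : ℕ} {a b : Fin p} {m : ℕ} (h : m ≤ (a : ℕ) + b) :
    ∃ a' b' : Fin p, a' ≤ a ∧ b' ≤ b ∧ (a' : ℕ) + b' = m := by
  refine ⟨⟨min (a : ℕ) m, by omega⟩, ⟨m - min (a : ℕ) m, by omega⟩, ?_, ?_, ?_⟩
  · rw [Fin.le_def]; simp
  · rw [Fin.le_def]; simp only; omega
  · simp only; omega

/-- Let `p` be prime, `F_q` of characteristic `p`, and
`C_1 ⊇ ⋯ ⊇ C_p` nested codes. With `MS_p = (binom{p-i}{j-1} mod p)_{i,j}` and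
`MS_p^* = (binom{p-i}{j-1} binom{p-1}{j-1} mod p)_{i,j}` and `C = [C_1,…,C_p]MS_p`,
one has `C^{*2} = [D_2, D_3, …, D_{p+1}]MS_p^*` where `D_l = ∑_{i+j=l} C_i * C_j`
(here indices `i,j` run through `1,…,p`; in the 0-indexed formalization below the
entry `(i,j)` of `MS_p` is `binom{p-1-i}{j}` and `D` is indexed by `m = l - 2`). -/
theorem msp_square
    {F : Type*} [Field F] [Fintype F] {p : ℕ} (hp : p.Prime) [CharP F p] {n : ℕ}
    (C : Fin p → Submodule F (Fin n → F))
    (hnested : ∀ i j : Fin p, i ≤ j → C j ≤ C i) :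
    schurProd
        (matrixProdCode C
          (Matrix.of fun i j : Fin p => (Nat.choose (p - 1 - (i : ℕ)) (j : ℕ) : F)))
        (matrixProdCode C
          (Matrix.of fun i j : Fin p => (Nat.choose (p - 1 - (i : ℕ)) (j : ℕ) : F))) =
      matrixProdCode
        (fun m : Fin p =>
          ⨆ (pr : Fin p × Fin p) (_ : (pr.1 : ℕ) + (pr.2 : ℕ) = (m : ℕ)),
            schurProd (C pr.1) (C pr.2))
        (Matrix.of fun i j : Fin p =>
          ((Nat.choose (p - 1 - (i : ℕ)) (j : ℕ) * Nat.choose (p - 1) (j : ℕ) : ℕ) : F)) := by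
  set A : Matrix (Fin p) (Fin p) F :=
    Matrix.of fun i j : Fin p => (Nat.choose (p - 1 - (i : ℕ)) (j : ℕ) : F) with hA
  set B : Matrix (Fin p) (Fin p) F := Matrix.of fun i j : Fin p =>
    ((Nat.choose (p - 1 - (i : ℕ)) (j : ℕ) * Nat.choose (p - 1) (j : ℕ) : ℕ) : F) with hB
  have hsign : ∀ j : ℕ, ((-1 : F) ^ j) * (-1) ^ j = 1 := fun j => by
    rw [← mul_pow]; simp
  have hAA : ∀ a b j : Fin p,
      A a j * A b j = (chooseSeq F a * chooseSeq F b) (j : ℕ) := fun a b j => by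
    simp only [hA, Matrix.of_apply, Pi.mul_apply]
    rw [cast_choose_sub_one_sub a.2 j.2, cast_choose_sub_one_sub b.2 j.2]
    linear_combination (chooseSeq F a j * chooseSeq F b j) * hsign j
  have hBm : ∀ m j : Fin p, B m j = chooseSeq F m (j : ℕ) := fun m j => by
    have h0 := cast_choose_sub_one_sub (F := F) hp.pos j.2
    rw [Nat.sub_zero, show chooseSeq F 0 (j : ℕ) = 1 by simp [chooseSeq], mul_one] at h0
    simp only [hB, Matrix.of_apply, Nat.cast_mul]
    rw [h0, cast_choose_sub_one_sub m.2 j.2]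
    linear_combination chooseSeq F m j * hsign j
  have hprod : ∀ (a b : Fin p) (x : Fin n → F),
      (fun jk : Fin p × Fin n => A a jk.1 * A b jk.1 * x jk.2)
        = seqTensor F p n (chooseSeq F a * chooseSeq F b) x := fun a b x =>
    funext fun jk => congrArg (· * x jk.2) (hAA a b jk.1)
  have hrow : ∀ (m : Fin p) (x : Fin n → F),
      (fun jk : Fin p × Fin n => B m jk.1 * x jk.2) = seqTensor F p n (chooseSeq F m) x :=
    fun m x => funext fun jk => congrArg (· * x jk.2) (hBm m jk.1)
  apply le_antisymm
  · refine schurProd_matrixProdCode_le fun a b c hc c' hc' => ?_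
    rw [hprod]
    refine seqTensor_mem_of_mem_chooseSpan (chooseSeq_mul_mem_chooseSpan b.2 a.2) ?_
    intro m hmp hm
    obtain ⟨a', b', ha, hb, hab⟩ := exists_fin_add_eq (Nat.lt_succ_iff.1 hm)
    rw [← hrow ⟨m, hmp⟩]
    refine mul_mem_matrixProdCode B ?_
    exact Submodule.mem_iSup_of_mem (a', b') (Submodule.mem_iSup_of_mem hab
      (Submodule.subset_span ⟨c, hnested _ _ ha hc, c', hnested _ _ hb hc', rfl⟩))
  · have key : ∀ m : ℕ, m < p → ∀ a b : Fin p, (a : ℕ) + b = m → ∀ c ∈ C a, ∀ c' ∈ C b,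
        seqTensor F p n (chooseSeq F m) (c * c')
          ∈ schurProd (matrixProdCode C A) (matrixProdCode C A) := by
      intro m
      induction m using Nat.strong_induction_on with
      | _ m ih =>
        rintro hm a b rfl c hc c' hc'
        obtain ⟨t, ht, hmem⟩ := exists_chooseSeq_mul_sub_mem (F := F) hm
        have hlow := seqTensor_mem_of_mem_chooseSpan (x := c * c') hmem fun m' hp' hm' => by
          obtain ⟨a', b', ha, hb, hab⟩ := exists_fin_add_eq hm'.le
          exact ih m' hm' hp' a' b' hab c (hnested _ _ ha hc) c' (hnested _ _ hb hc')
        have htop : seqTensor F p n (chooseSeq F a * chooseSeq F b) (c * c')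
            ∈ schurProd (matrixProdCode C A) (matrixProdCode C A) := by
          rw [← hprod]
          refine Submodule.subset_span ⟨_, mul_mem_matrixProdCode A hc, _,
            mul_mem_matrixProdCode A hc', funext fun jk => ?_⟩
          simp only [Pi.mul_apply]
          ring
        rw [← Submodule.smul_mem_iff _ ht]
        have h := sub_mem htop hlow
        rwa [map_sub, map_smul, LinearMap.sub_apply, LinearMap.smul_apply, sub_sub_cancel] at h
    refine matrixProdCode_le fun m x hx => ?_
    rw [hrow]
    have hle : (⨆ (pr : Fin p × Fin p) (_ : (pr.1 : ℕ) + (pr.2 : ℕ) = (m : ℕ)),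
        schurProd (C pr.1) (C pr.2)) ≤ (schurProd (matrixProdCode C A) (matrixProdCode C A)).comap
          (seqTensor F p n (chooseSeq F m)) := by
      refine iSup₂_le fun pr hpr => Submodule.span_le.2 ?_
      rintro _ ⟨c, hc, c', hc', rfl⟩
      exact key m m.2 pr.1 pr.2 hpr c hc c' hc'
    exact hle hx
end
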